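/- arXiv:1207.6480 — 2 statements merged into one kernel-verified Lean document; each statement's English description precedes it below -/
import Mathlib

section
/- Let N ≥ 1, let Ω ⊆ ℝ^N be an open set, and let u ∈ L^1(Ω) have a weak gradient g ∈ L^1(Ω; ℝ^N). Then for every constant c ∈ ℝ, g = 0 almost everywhere on the level set {x ∈ Ω : u(x) = c}. -/
open MeasureTheory Filter Topology RealInnerProductSpace

noncomputable section

/-- `φ` is a test function on `Ω`: smooth with compact support contained in `Ω`. -/
def IsTestFun (N : ℕ) (Ω : Set (EuclideanSpace ℝ (Fin N)))
    (φ : EuclideanSpace ℝ (Fin N) → ℝ) : Prop :=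
  ContDiff ℝ (⊤ : ℕ∞) φ ∧ HasCompactSupport φ ∧ tsupport φ ⊆ Ω

/-- `g ∈ L¹(Ω; ℝ^N)` is the weak gradient of `u ∈ L¹(Ω)`:
for every test function `φ` and every index `i`, `∫_Ω u ∂ᵢφ = -∫_Ω gᵢ φ`. -/
def IsWeakGradient (N : ℕ) (Ω : Set (EuclideanSpace ℝ (Fin N)))
    (u : EuclideanSpace ℝ (Fin N) → ℝ)
    (g : EuclideanSpace ℝ (Fin N) → EuclideanSpace ℝ (Fin N)) : Prop :=
  IntegrableOn u Ω volume ∧ IntegrableOn g Ω volume ∧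
  ∀ φ : EuclideanSpace ℝ (Fin N) → ℝ, IsTestFun N Ω φ → ∀ i : Fin N,
    ∫ x in Ω, u x * fderiv ℝ φ x (EuclideanSpace.single i 1) ∂volume
      = - ∫ x in Ω, g x i * φ x ∂volume

/-- `u ∈ W₀^{1,1}(Ω)` with weak gradient `g`: `g` is the weak gradient of `u`, and there is a
sequence of test functions converging to `u` in `L¹(Ω)` whose gradients converge to `g`
in `L¹(Ω; ℝ^N)`. -/
def MemW0_1_1 (N : ℕ) (Ω : Set (EuclideanSpace ℝ (Fin N)))
    (u : EuclideanSpace ℝ (Fin N) → ℝ)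
    (g : EuclideanSpace ℝ (Fin N) → EuclideanSpace ℝ (Fin N)) : Prop :=
  IsWeakGradient N Ω u g ∧
  ∃ φ : ℕ → EuclideanSpace ℝ (Fin N) → ℝ,
    (∀ n, IsTestFun N Ω (φ n)) ∧
    Tendsto (fun n => ∫ x in Ω, |φ n x - u x| ∂volume) atTop (𝓝 0) ∧
    Tendsto (fun n => ∫ x in Ω, ‖gradient (φ n) x - g x‖ ∂volume) atTop (𝓝 0)

open scoped Convolution ContDiff

lemma scheffe_aux {α : Type*} [MeasurableSpace α] {μ : Measure α} {f : ℕ → α → ℝ} {h : α → ℝ}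
    (hf : ∀ n, Integrable (f n) μ) (hh : Integrable h μ) (hpos : ∀ n x, 0 ≤ f n x)
    (hlim : ∀ᵐ x ∂μ, Tendsto (fun n => f n x) atTop (𝓝 (h x)))
    (hint : ∀ n, ∫ x, f n x ∂μ = ∫ x, h x ∂μ) :
    Tendsto (fun n => ∫ x, |f n x - h x| ∂μ) atTop (𝓝 0) := by
  have key : ∀ n, ∫ x, |f n x - h x| ∂μ = 2 * ∫ x, max (h x - f n x) 0 ∂μ := by
    intro n
    have i1 : Integrable (fun x => f n x - h x) μ := (hf n).sub hh
    have i2 : Integrable (fun x => max (h x - f n x) 0) μ := (hh.sub (hf n)).pos_part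
    have : ∀ x, |f n x - h x| = (f n x - h x) + 2 * max (h x - f n x) 0 := by
      intro x
      rcases le_total (f n x) (h x) with H | H
      · rw [abs_of_nonpos (by linarith), max_eq_left (by linarith)]; ring
      · rw [abs_of_nonneg (by linarith), max_eq_right (by linarith)]; ring
    simp_rw [this]
    rw [integral_add i1 (i2.const_mul 2), integral_sub (hf n) hh, hint n, integral_const_mul]
    ring
  simp_rw [key]
  have : Tendsto (fun n => ∫ x, max (h x - f n x) 0 ∂μ) atTop (𝓝 (∫ x, (0:ℝ) ∂μ)) := by
    refine tendsto_integral_of_dominated_convergence (fun x => |h x|)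
      (fun n => ((hh.sub (hf n)).pos_part).aestronglyMeasurable) hh.abs ?_ ?_
    · intro n
      refine Eventually.of_forall fun x => ?_
      rw [Real.norm_eq_abs, abs_of_nonneg (le_max_right _ _)]
      refine max_le ?_ (abs_nonneg _)
      linarith [hpos n x, le_abs_self (h x)]
    · filter_upwards [hlim] with x hx
      have := (tendsto_const_nhds (x := h x)).sub hx
      simpa using this.max (tendsto_const_nhds (x := (0:ℝ)))
  simpa using this.const_mul 2

section
variable {E : Type*} [NormedAddCommGroup E] [InnerProductSpace ℝ E] [FiniteDimensional ℝ E]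
  [MeasurableSpace E] [BorelSpace E]

lemma moll_integrable (ρ : ContDiffBump (0 : E)) {G : E → ℝ} (hG : Integrable G volume) :
    Integrable (ρ.normed volume ⋆[ContinuousLinearMap.lsmul ℝ ℝ, volume] G) volume :=
  Integrable.integrable_convolution _ ρ.integrable_normed hG

lemma moll_L1_pos {ρ : ℕ → ContDiffBump (0 : E)}
    (h0 : Tendsto (fun n => (ρ n).rOut) atTop (𝓝 0))
    (h1 : ∀ n, (ρ n).rOut ≤ 2 * (ρ n).rIn) {G : E → ℝ} (hG : Integrable G volume)
    (hpos : ∀ x, 0 ≤ G x) :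
    Tendsto (fun n => ∫ x, |((ρ n).normed volume ⋆[ContinuousLinearMap.lsmul ℝ ℝ, volume] G) x
      - G x|) atTop (𝓝 0) := by
  refine scheffe_aux (fun n => moll_integrable (ρ n) hG) hG ?_ ?_ ?_
  · intro n x
    rw [convolution_lsmul]
    exact integral_nonneg fun t => mul_nonneg ((ρ n).nonneg_normed _) (hpos _)
  · exact ContDiffBump.ae_convolution_tendsto_right_of_locallyIntegrable (K := 2) h0
      (Eventually.of_forall h1) hG.locallyIntegrable
  · intro n
    rw [integral_convolution _ (ρ n).integrable_normed hG, (ρ n).integral_normed]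
    simp

lemma moll_exists (ρ : ContDiffBump (0 : E)) {G : E → ℝ} (hG : Integrable G volume) :
    ConvolutionExists (ρ.normed volume) G (ContinuousLinearMap.lsmul ℝ ℝ) volume :=
  ρ.hasCompactSupport_normed.convolutionExists_left _ ρ.continuous_normed hG.locallyIntegrable

lemma moll_L1 {ρ : ℕ → ContDiffBump (0 : E)}
    (h0 : Tendsto (fun n => (ρ n).rOut) atTop (𝓝 0))
    (h1 : ∀ n, (ρ n).rOut ≤ 2 * (ρ n).rIn) {G : E → ℝ} (hG : Integrable G volume) :
    Tendsto (fun n => ∫ x, |((ρ n).normed volume ⋆[ContinuousLinearMap.lsmul ℝ ℝ, volume] G) x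
      - G x|) atTop (𝓝 0) := by
  have p1 : Integrable (fun x => max (G x) 0) volume := hG.pos_part
  have p2 : Integrable (fun x => max (-G x) 0) volume := hG.neg_part
  have l1 := moll_L1_pos h0 h1 p1 (fun x => le_max_right _ _)
  have l2 := moll_L1_pos h0 h1 p2 (fun x => le_max_right _ _)
  have hGd : ∀ x, G x = max (G x) 0 - max (-G x) 0 := by
    intro x
    rcases le_total (G x) 0 with H | H
    · rw [max_eq_right H, max_eq_left (by linarith)]; ring
    · rw [max_eq_left H, max_eq_right (by linarith)]; ring
  have l3 := l1.add l2
  rw [add_zero] at l3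
  refine squeeze_zero (fun n => integral_nonneg fun x => abs_nonneg _) (fun n => ?_) l3
  have i1 := ((moll_integrable (ρ n) p1).sub p1).abs
  have i2 := ((moll_integrable (ρ n) p2).sub p2).abs
  have i0 := ((moll_integrable (ρ n) hG).sub hG).abs
  refine le_of_le_of_eq ?_ (integral_add i1 i2)
  refine integral_mono i0 (i1.add i2) fun x => ?_
  have e : ((ρ n).normed volume ⋆[ContinuousLinearMap.lsmul ℝ ℝ, volume] G) x
      = ((ρ n).normed volume ⋆[ContinuousLinearMap.lsmul ℝ ℝ, volume] (fun x => max (G x) 0)) x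
      - ((ρ n).normed volume ⋆[ContinuousLinearMap.lsmul ℝ ℝ, volume] (fun x => max (-G x) 0)) x := by
    have a1 := moll_exists (ρ n) p1 x
    have a2 := moll_exists (ρ n) p2 x
    rw [convolution_lsmul, convolution_lsmul, convolution_lsmul]
    refine Eq.trans ?_ (integral_sub a1 a2)
    refine integral_congr_ae (Eventually.of_forall fun t => ?_)
    change (ρ n).normed volume t • G (x - t) = (ρ n).normed volume t • max (G (x - t)) 0
      - (ρ n).normed volume t • max (-G (x - t)) 0
    rw [← smul_sub, ← hGd]
  simp only [Pi.sub_apply, Pi.add_apply]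
  rw [e]
  conv_lhs => rw [hGd x]
  refine le_trans (le_of_eq ?_) (abs_sub _ _)
  congr 1; ring

end

lemma moll_deriv (N : ℕ) (Ω : Set (EuclideanSpace ℝ (Fin N))) (hΩ : IsOpen Ω)
    (u : EuclideanSpace ℝ (Fin N) → ℝ)
    (g : EuclideanSpace ℝ (Fin N) → EuclideanSpace ℝ (Fin N))
    (hu : IsWeakGradient N Ω u g) (i : Fin N)
    (ρ : ContDiffBump (0 : EuclideanSpace ℝ (Fin N))) (x : EuclideanSpace ℝ (Fin N))
    (hx : Metric.closedBall x ρ.rOut ⊆ Ω) :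
    fderiv ℝ (ρ.normed volume ⋆[ContinuousLinearMap.lsmul ℝ ℝ, volume] (Ω.indicator u)) x
      (EuclideanSpace.single i 1)
    = (ρ.normed volume ⋆[ContinuousLinearMap.lsmul ℝ ℝ, volume] (Ω.indicator (fun y => g y i))) x
    := by
  obtain ⟨hu1, hg1, hw⟩ := hu
  have hU : Integrable (Ω.indicator u) volume := (integrable_indicator_iff hΩ.measurableSet).2 hu1
  have hc : ContDiff ℝ ∞ (ρ.normed volume) := ρ.contDiff_normed
  have hc1 : ContDiff ℝ 1 (ρ.normed volume) := ρ.contDiff_normed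
  have hcs : HasCompactSupport (ρ.normed volume) := ρ.hasCompactSupport_normed
  have hD := hcs.hasFDerivAt_convolution_left (ContinuousLinearMap.lsmul ℝ ℝ) hc1
    hU.locallyIntegrable x
  rw [hD.fderiv]
  have hex : ConvolutionExistsAt (fderiv ℝ (ρ.normed volume)) (Ω.indicator u) x
      ((ContinuousLinearMap.lsmul ℝ ℝ).precompL (EuclideanSpace ℝ (Fin N))) volume :=
    (hcs.fderiv ℝ).convolutionExists_left _ (hc1.continuous_fderiv (by norm_num))
      hU.locallyIntegrable x
  have hex' := hex.integrable_swap
  rw [convolution_eq_swap, ContinuousLinearMap.integral_apply hex', convolution_lsmul_swap]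
  set ψ : EuclideanSpace ℝ (Fin N) → ℝ := fun t => ρ.normed volume (x - t) with hψ
  have hψs : tsupport ψ ⊆ Metric.closedBall x ρ.rOut := by
    refine closure_minimal ?_ Metric.isClosed_closedBall
    intro t ht
    have : x - t ∈ Function.support (ρ.normed volume) := ht
    rw [ρ.support_normed_eq] at this
    rw [Metric.mem_closedBall, dist_comm, dist_eq_norm]
    simpa using (mem_ball_zero_iff.1 this).le
  have hψd : ∀ t, fderiv ℝ ψ t (EuclideanSpace.single i 1)
      = - fderiv ℝ (ρ.normed volume) (x - t) (EuclideanSpace.single i 1) := by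
    intro t
    have h1 : HasFDerivAt (fun t : EuclideanSpace ℝ (Fin N) => x - t)
      (-(ContinuousLinearMap.id ℝ (EuclideanSpace ℝ (Fin N)))) t := (hasFDerivAt_id t).const_sub x
    have h2 := ((hc1.differentiable (by norm_num) (x - t)).hasFDerivAt).comp t h1
    have h3 : fderiv ℝ ψ t = _ := h2.fderiv
    rw [h3]; simp
  have htest : IsTestFun N Ω ψ := by
    refine ⟨hc.comp (contDiff_const.sub contDiff_id), ?_, hψs.trans hx⟩
    exact HasCompactSupport.of_support_subset_isCompact (isCompact_closedBall x ρ.rOut)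
      (subset_closure.trans hψs)
  have := hw ψ htest i
  simp_rw [hψd] at this
  rw [← integral_indicator hΩ.measurableSet, ← integral_indicator hΩ.measurableSet,
    ← integral_neg] at this
  have t1 : ∀ t, (((ContinuousLinearMap.lsmul ℝ ℝ).precompL (EuclideanSpace ℝ (Fin N)))
      (fderiv ℝ (ρ.normed volume) (x - t)) (Ω.indicator u t)) (EuclideanSpace.single i 1)
      = - Ω.indicator (fun x_1 => u x_1 *
        -(fderiv ℝ (ρ.normed volume) (x - x_1)) (EuclideanSpace.single i 1)) t := by
    intro t
    by_cases h : t ∈ Ω <;> simp [h, ContinuousLinearMap.precompL_apply]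
    ring
  simp_rw [t1]
  rw [integral_neg, this, integral_neg, neg_neg]
  congr 1; ext t
  by_cases h : t ∈ Ω <;> simp [h, hψ, mul_comm]

lemma weak_chain (N : ℕ) (Ω : Set (EuclideanSpace ℝ (Fin N))) (hΩ : IsOpen Ω)
    (u : EuclideanSpace ℝ (Fin N) → ℝ)
    (g : EuclideanSpace ℝ (Fin N) → EuclideanSpace ℝ (Fin N))
    (hu : IsWeakGradient N Ω u g) (i : Fin N) (F F' : ℝ → ℝ) (M : ℝ)
    (hF : ∀ t, HasDerivAt F (F' t) t) (hF'c : Continuous F') (hM : ∀ t, |F t| ≤ M)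
    (hF'1 : ∀ t, |F' t| ≤ 1) (φ : EuclideanSpace ℝ (Fin N) → ℝ) (hφ : IsTestFun N Ω φ) :
    ∫ x, F (Ω.indicator u x) * fderiv ℝ φ x (EuclideanSpace.single i 1)
      = - ∫ x, F' (Ω.indicator u x) * Ω.indicator (fun y => g y i) x * φ x := by
  have hU : Integrable (Ω.indicator u) volume :=
    (integrable_indicator_iff hΩ.measurableSet).2 hu.1
  have hgi : IntegrableOn (fun y => g y i) Ω volume :=
    (EuclideanSpace.proj (𝕜 := ℝ) i).integrable_comp hu.2.1
  have hG : Integrable (Ω.indicator (fun y => g y i)) volume :=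
    (integrable_indicator_iff hΩ.measurableSet).2 hgi
  have hder := moll_deriv N Ω hΩ u g hu i
  set U := Ω.indicator u
  set G := Ω.indicator (fun y => g y i)
  set e : EuclideanSpace ℝ (Fin N) := EuclideanSpace.single i 1
  obtain ⟨hφc, hφs, hφΩ⟩ := hφ
  have hFc : Continuous F := continuous_iff_continuousAt.2 fun t => (hF t).continuousAt
  have hdφc : Continuous (fun x => fderiv ℝ φ x e) :=
    (hφc.continuous_fderiv (by simp)).clm_apply continuous_const
  have hdφs : HasCompactSupport (fun x => fderiv ℝ φ x e) := hφs.fderiv_apply ℝ e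
  have hdφi : Integrable (fun x => fderiv ℝ φ x e) volume :=
    hdφc.integrable_of_hasCompactSupport hdφs
  obtain ⟨C, hC⟩ := hφs.exists_bound_of_continuous hφc.continuous
  let ρ : ℕ → ContDiffBump (0 : EuclideanSpace ℝ (Fin N)) := fun n =>
    ⟨1 / ((n : ℝ) + 1), 2 * (1 / ((n : ℝ) + 1)), by positivity, by
      have : 0 < 1 / ((n : ℝ) + 1) := by positivity
      linarith⟩
  have h0 : Tendsto (fun n => (ρ n).rOut) atTop (𝓝 0) := by
    have := (tendsto_one_div_add_atTop_nhds_zero_nat (𝕜 := ℝ)).const_mul 2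
    rw [mul_zero] at this
    exact this
  have h1 : ∀ n, (ρ n).rOut ≤ 2 * (ρ n).rIn := fun n => le_rfl
  set un : ℕ → EuclideanSpace ℝ (Fin N) → ℝ := fun n =>
    ((ρ n).normed volume ⋆[ContinuousLinearMap.lsmul ℝ ℝ, volume] U)
  set Gn : ℕ → EuclideanSpace ℝ (Fin N) → ℝ := fun n =>
    ((ρ n).normed volume ⋆[ContinuousLinearMap.lsmul ℝ ℝ, volume] G)
  have hun : ∀ n, ContDiff ℝ 1 (un n) := fun n =>
    (ρ n).hasCompactSupport_normed.contDiff_convolution_left (n := 1) _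
      (ρ n).contDiff_normed hU.locallyIntegrable
  have hGn : ∀ n, Integrable (Gn n) volume := fun n => moll_integrable (ρ n) hG
  have hlim : ∀ᵐ x, Tendsto (fun n => un n x) atTop (𝓝 (U x)) :=
    ContDiffBump.ae_convolution_tendsto_right_of_locallyIntegrable (K := 2) h0
      (Eventually.of_forall h1) hU.locallyIntegrable
  have hL1 : Tendsto (fun n => ∫ x, |Gn n x - G x|) atTop (𝓝 0) := moll_L1 h0 h1 hG
  -- identity for smooth approximations
  obtain ⟨δ, hδ, hδΩ⟩ := IsCompact.exists_cthickening_subset_open hφs hΩ hφΩ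
  have hid : ∀ᶠ n in atTop, ∫ x, F (un n x) * fderiv ℝ φ x e
      = - ∫ x, F' (un n x) * Gn n x * φ x := by
    filter_upwards [h0.eventually (gt_mem_nhds hδ)] with n hn
    have hd : ∀ x, HasFDerivAt (fun x => F (un n x)) (F' (un n x) • fderiv ℝ (un n) x) x :=
      fun x => (hF _).comp_hasFDerivAt x ((hun n).differentiable (by norm_num) x).hasFDerivAt
    have hfd : ∀ x, fderiv ℝ (fun x => F (un n x)) x e * φ x = F' (un n x) * Gn n x * φ x := by
      intro x
      by_cases hx : x ∈ tsupport φ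
      · rw [(hd x).fderiv, smul_apply, smul_eq_mul]
        have : fderiv ℝ (un n) x e = Gn n x := by
          refine hder (ρ n) x (subset_trans ?_ hδΩ)
          exact (Metric.closedBall_subset_closedBall hn.le).trans
            (Metric.closedBall_subset_cthickening hx δ)
        rw [this]
      · rw [image_eq_zero_of_notMem_tsupport hx]; simp
    simp_rw [← hfd]
    have cF : Continuous (fun x => F (un n x)) := hFc.comp (hun n).continuous
    have cF' : Continuous (fun x => fderiv ℝ (fun x => F (un n x)) x e) := by
      have : (fun x => fderiv ℝ (fun x => F (un n x)) x e)
          = fun x => F' (un n x) * fderiv ℝ (un n) x e := by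
        ext x; rw [(hd x).fderiv]; simp
      rw [this]
      exact (hF'c.comp (hun n).continuous).mul
        (((hun n).continuous_fderiv (by norm_num)).clm_apply continuous_const)
    refine integral_mul_fderiv_eq_neg_fderiv_mul_of_integrable ?_ ?_ ?_ ?_ ?_
    · exact (cF'.mul hφc.continuous).integrable_of_hasCompactSupport hφs.mul_left
    · exact (cF.mul hdφc).integrable_of_hasCompactSupport hdφs.mul_left
    · exact (cF.mul hφc.continuous).integrable_of_hasCompactSupport hφs.mul_left
    · exact fun x _ => (hd x).differentiableAt
    · exact fun x _ => hφc.differentiable (by simp) x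
  -- left limit
  have limL : Tendsto (fun n => ∫ x, F (un n x) * fderiv ℝ φ x e) atTop
      (𝓝 (∫ x, F (U x) * fderiv ℝ φ x e)) := by
    refine tendsto_integral_of_dominated_convergence (fun x => M * |fderiv ℝ φ x e|)
      (fun n => ((hFc.comp (hun n).continuous).mul hdφc).aestronglyMeasurable)
      (hdφi.abs.const_mul M) ?_ ?_
    · intro n
      refine Eventually.of_forall fun x => ?_
      rw [Real.norm_eq_abs, abs_mul]
      exact mul_le_mul_of_nonneg_right (hM _) (abs_nonneg _)
    · filter_upwards [hlim] with x hx
      exact ((hFc.tendsto _).comp hx).mul_const _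
  -- right limit, main part
  have limR1 : Tendsto (fun n => ∫ x, F' (un n x) * G x * φ x) atTop
      (𝓝 (∫ x, F' (U x) * G x * φ x)) := by
    refine tendsto_integral_of_dominated_convergence (fun x => |G x| * C)
      (fun n => ((hF'c.comp (hun n).continuous).aestronglyMeasurable.mul
        hG.aestronglyMeasurable).mul hφc.continuous.aestronglyMeasurable)
      (hG.abs.mul_const C) ?_ ?_
    · intro n
      refine Eventually.of_forall fun x => ?_
      rw [Real.norm_eq_abs, abs_mul, abs_mul]
      refine mul_le_mul ?_ (hC x) (abs_nonneg _) (abs_nonneg _)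
      exact mul_le_of_le_one_left (abs_nonneg _) (hF'1 _)
    · filter_upwards [hlim] with x hx
      exact (((hF'c.tendsto _).comp hx).mul_const _).mul_const _
  have bnd : ∀ n (H : EuclideanSpace ℝ (Fin N) → ℝ), Integrable H volume →
      Integrable (fun x => F' (un n x) * H x * φ x) volume := by
    intro n H hH
    refine (hH.abs.mul_const C).mono' (((hF'c.comp (hun n).continuous).aestronglyMeasurable.mul
        hH.aestronglyMeasurable).mul hφc.continuous.aestronglyMeasurable) ?_
    refine Eventually.of_forall fun x => ?_
    rw [Real.norm_eq_abs, abs_mul, abs_mul]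
    refine mul_le_mul ?_ (hC x) (abs_nonneg _) (abs_nonneg _)
    exact mul_le_of_le_one_left (abs_nonneg _) (hF'1 _)
  have limR2 : Tendsto (fun n => ∫ x, F' (un n x) * (Gn n x - G x) * φ x) atTop (𝓝 0) := by
    have l := hL1.mul_const C
    rw [zero_mul] at l
    refine squeeze_zero_norm (fun n => ?_) l
    rw [← integral_mul_const]
    refine norm_integral_le_of_norm_le ((((hGn n).sub hG).abs).mul_const C)
      (Eventually.of_forall fun x => ?_)
    rw [Real.norm_eq_abs, abs_mul, abs_mul]
    refine mul_le_mul ?_ (hC x) (abs_nonneg _) (abs_nonneg _)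
    exact mul_le_of_le_one_left (abs_nonneg _) (hF'1 _)
  have limR : Tendsto (fun n => - ∫ x, F' (un n x) * Gn n x * φ x) atTop
      (𝓝 (- ∫ x, F' (U x) * G x * φ x)) := by
    have := (limR1.add limR2).neg
    rw [add_zero] at this
    refine this.congr fun n => ?_
    have b2 : Integrable (fun x => F' (un n x) * (Gn n x - G x) * φ x) volume :=
      bnd n _ ((hGn n).sub hG)
    rw [← integral_add (bnd n _ hG) b2]
    congr 2; ext x; ring
  exact tendsto_nhds_unique (limL.congr' hid) limR

lemma level_integral_zero (N : ℕ) (Ω : Set (EuclideanSpace ℝ (Fin N))) (hΩ : IsOpen Ω)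
    (u : EuclideanSpace ℝ (Fin N) → ℝ)
    (g : EuclideanSpace ℝ (Fin N) → EuclideanSpace ℝ (Fin N))
    (hu : IsWeakGradient N Ω u g) (i : Fin N) (c : ℝ)
    (φ : EuclideanSpace ℝ (Fin N) → ℝ) (hφ : IsTestFun N Ω φ) :
    ∫ x, (if Ω.indicator u x = c then (1:ℝ) else 0) * Ω.indicator (fun y => g y i) x * φ x = 0 := by
  have hU : Integrable (Ω.indicator u) volume :=
    (integrable_indicator_iff hΩ.measurableSet).2 hu.1
  have hgi : IntegrableOn (fun y => g y i) Ω volume :=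
    (EuclideanSpace.proj (𝕜 := ℝ) i).integrable_comp hu.2.1
  have hG : Integrable (Ω.indicator (fun y => g y i)) volume :=
    (integrable_indicator_iff hΩ.measurableSet).2 hgi
  have hch := fun F F' M a b d f => weak_chain N Ω hΩ u g hu i F F' M a b d f φ hφ
  set U := Ω.indicator u
  set G := Ω.indicator (fun y => g y i)
  set e : EuclideanSpace ℝ (Fin N) := EuclideanSpace.single i 1
  obtain ⟨hφc, hφs, hφΩ⟩ := hφ
  have hdφi : Integrable (fun x => fderiv ℝ φ x e) volume :=
    ((hφc.continuous_fderiv (by simp)).clm_apply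
      continuous_const).integrable_of_hasCompactSupport (hφs.fderiv_apply ℝ e)
  obtain ⟨C, hC⟩ := hφs.exists_bound_of_continuous hφc.continuous
  -- parameter k = 1/ε
  let k : ℕ → ℝ := fun n => (n : ℝ) + 1
  have hk : ∀ n, 0 < k n := fun n => by positivity
  let F : ℕ → ℝ → ℝ := fun n t => (k n)⁻¹ * Real.arctan (k n * (t - c))
  let F' : ℕ → ℝ → ℝ := fun n t => 1 / (1 + (k n * (t - c)) ^ 2)
  have hF : ∀ n t, HasDerivAt (F n) (F' n t) t := by
    intro n t
    have h1 : HasDerivAt (fun t => k n * (t - c)) (k n * 1) t :=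
      ((hasDerivAt_id t).sub_const c).const_mul (k n)
    have h2 := (h1.arctan).const_mul (k n)⁻¹
    refine h2.congr_deriv ?_
    have := (hk n).ne'
    simp only [F']
    field_simp
  have hF'c : ∀ n, Continuous (F' n) := by
    intro n
    refine continuous_const.div (by fun_prop) fun t => by positivity
  have hM : ∀ n t, |F n t| ≤ (k n)⁻¹ * 2 := by
    intro n t
    simp only [F]
    rw [abs_mul, abs_of_pos (inv_pos.2 (hk n))]
    refine mul_le_mul_of_nonneg_left ?_ (inv_pos.2 (hk n)).le
    rw [abs_le]
    constructor <;> linarith [Real.neg_pi_div_two_lt_arctan (k n * (t - c)),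
      Real.arctan_lt_pi_div_two (k n * (t - c)), Real.pi_le_four]
  have hF'1 : ∀ n t, |F' n t| ≤ 1 := by
    intro n t
    simp only [F']
    rw [abs_of_pos (by positivity), div_le_one (by positivity)]
    nlinarith [sq_nonneg (k n * (t - c))]
  have hid := fun n => hch (F n) (F' n) _ (hF n) (hF'c n) (hM n) (hF'1 n)
  have hkt : Tendsto (fun n => (k n)⁻¹) atTop (𝓝 0) := by
    simpa [k] using (tendsto_one_div_add_atTop_nhds_zero_nat (𝕜 := ℝ))
  have limL : Tendsto (fun n => ∫ x, F n (U x) * fderiv ℝ φ x e) atTop (𝓝 0) := by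
    have l := (hkt.mul_const 2).mul_const (∫ x, |fderiv ℝ φ x e|)
    rw [zero_mul, zero_mul] at l
    refine squeeze_zero_norm (fun n => ?_) l
    rw [← integral_const_mul]
    refine norm_integral_le_of_norm_le (hdφi.abs.const_mul _) (Eventually.of_forall fun x => ?_)
    rw [Real.norm_eq_abs, abs_mul]
    exact mul_le_mul_of_nonneg_right (hM n _) (abs_nonneg _)
  have limR : Tendsto (fun n => ∫ x, F' n (U x) * G x * φ x) atTop
      (𝓝 (∫ x, (if U x = c then (1:ℝ) else 0) * G x * φ x)) := by
    refine tendsto_integral_of_dominated_convergence (fun x => |G x| * C)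
      (fun n => (((hF'c n).comp_aestronglyMeasurable hU.aestronglyMeasurable).mul
        hG.aestronglyMeasurable).mul hφc.continuous.aestronglyMeasurable)
      (hG.abs.mul_const C) ?_ ?_
    · intro n
      refine Eventually.of_forall fun x => ?_
      rw [Real.norm_eq_abs, abs_mul, abs_mul]
      refine mul_le_mul ?_ (hC x) (abs_nonneg _) (abs_nonneg _)
      exact mul_le_of_le_one_left (abs_nonneg _) (hF'1 _ _)
    · refine Eventually.of_forall fun x => ?_
      refine Tendsto.mul_const _ (Tendsto.mul_const _ ?_)
      simp only [F']
      split_ifs with h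
      · simp [h]
      · have hkk : Tendsto k atTop atTop :=
          tendsto_atTop_add_const_right _ _ tendsto_natCast_atTop_atTop
        have hp : 0 < (U x - c) ^ 2 := by
          have : U x - c ≠ 0 := sub_ne_zero.2 h
          positivity
        simp_rw [one_div, mul_pow]
        refine Tendsto.inv_tendsto_atTop ?_
        refine tendsto_atTop_add_const_left _ _ ?_
        exact ((tendsto_pow_atTop (by norm_num)).comp hkk).atTop_mul_const hp
  have := tendsto_nhds_unique (limL.congr hid) limR.neg
  linarith


/-- If `u ∈ L¹(Ω)` has weak gradient `g ∈ L¹(Ω; ℝ^N)`, then for every constant `c`,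
`g = 0` almost everywhere on the level set `{u = c}`. -/
theorem weakGradient_ae_zero_on_level_set (N : ℕ) (hN : 1 ≤ N)
    (Ω : Set (EuclideanSpace ℝ (Fin N))) (hΩ : IsOpen Ω)
    (u : EuclideanSpace ℝ (Fin N) → ℝ)
    (g : EuclideanSpace ℝ (Fin N) → EuclideanSpace ℝ (Fin N))
    (hu : IsWeakGradient N Ω u g) :
    ∀ c : ℝ, ∀ᵐ x ∂(volume.restrict {x ∈ Ω | u x = c}), g x = 0 := by
  intro c
  have hU : Integrable (Ω.indicator u) volume :=
    (integrable_indicator_iff hΩ.measurableSet).2 hu.1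
  have key : ∀ i : Fin N, ∀ᵐ x, x ∈ Ω →
      (if Ω.indicator u x = c then (1:ℝ) else 0) * Ω.indicator (fun y => g y i) x = 0 := by
    intro i
    have hgi : IntegrableOn (fun y => g y i) Ω volume :=
      (EuclideanSpace.proj (𝕜 := ℝ) i).integrable_comp hu.2.1
    have hG : Integrable (Ω.indicator (fun y => g y i)) volume :=
      (integrable_indicator_iff hΩ.measurableSet).2 hgi
    have hm : AEStronglyMeasurable
        (fun x => if Ω.indicator u x = c then (1:ℝ) else 0) volume := by
      have hmeas : Measurable (fun t : ℝ => if t = c then (1:ℝ) else 0) :=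
        Measurable.ite (measurableSet_singleton c) measurable_const measurable_const
      exact (hmeas.comp_aemeasurable hU.aemeasurable).aestronglyMeasurable
    have hi : Integrable (fun x => (if Ω.indicator u x = c then (1:ℝ) else 0)
        * Ω.indicator (fun y => g y i) x) volume := by
      refine hG.abs.mono' (hm.mul hG.aestronglyMeasurable) (Eventually.of_forall fun x => ?_)
      rw [Real.norm_eq_abs, abs_mul]
      refine mul_le_of_le_one_left (abs_nonneg _) ?_
      split_ifs <;> simp
    refine hΩ.ae_eq_zero_of_integral_contDiff_smul_eq_zero
      (hi.locallyIntegrable.locallyIntegrableOn _) ?_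
    intro φ h1 h2 h3
    refine Eq.trans ?_ (level_integral_zero N Ω hΩ u g hu i c φ ⟨h1, h2, h3⟩)
    congr 1; ext x; rw [smul_eq_mul, mul_comm]
  have hnull : NullMeasurableSet {x ∈ Ω | u x = c} volume := by
    have : {x ∈ Ω | u x = c} = Ω ∩ (Ω.indicator u) ⁻¹' {c} := by
      ext x
      by_cases h : x ∈ Ω <;> simp [h]
    rw [this]
    exact hΩ.measurableSet.nullMeasurableSet.inter
      (hU.aemeasurable.nullMeasurableSet_preimage (measurableSet_singleton c))
  rw [ae_restrict_iff'₀ hnull]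
  filter_upwards [ae_all_iff.2 key] with x hx hxc
  ext i
  have := hx i hxc.1
  simpa [hxc.1, hxc.2] using this
end
end

section
/- Let N ≥ 1, let B_1(0) ⊆ ℝ^N be the open unit ball, let 0 < r < 1, and define u_r : B_1(0) → ℝ by u_r(x) = 1 - |x|² if |x| ≥ r and u_r(x) = 1 - r² if |x| < r. Then: (i) u_r ∈ W_0^{1,1}(B_1(0)), with weak gradient g_r(x) = -2x for |x| > r and g_r(x) = 0 for |x| < r; (ii) there exists a smooth bounded vector field Z : B_1(0) → ℝ^N with Z(x) = -x/|x| for all x with r ≤ |x| < 1, such that g_r(x) · Z(x) = |g_r(x)| for almost every x ∈ B_1(0) and the divergence div Z belongs to L^∞(B_1(0)). -/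
open MeasureTheory Filter Topology RealInnerProductSpace

noncomputable section

/-- Smooth cut-off density approximating the indicator of `(r², 1)`. -/
def rhoAux (r : ℝ) (n : ℕ) (s : ℝ) : ℝ :=
  Real.smoothTransition (((n : ℝ) + 1) * (s - r ^ 2)) *
    Real.smoothTransition (((n : ℝ) + 1) * (1 - s) - 1)

/-- Primitive of `-rhoAux` vanishing at `1`. -/
def FAux (r : ℝ) (n : ℕ) (t : ℝ) : ℝ := - ∫ s in (1 : ℝ)..t, rhoAux r n s

lemma rhoAux_contDiff (r : ℝ) (n : ℕ) : ContDiff ℝ (⊤ : ℕ∞) (rhoAux r n) := by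
  unfold rhoAux
  apply ContDiff.mul
  · exact Real.smoothTransition.contDiff.comp (by fun_prop)
  · exact Real.smoothTransition.contDiff.comp (by fun_prop)

lemma rhoAux_nonneg (r : ℝ) (n : ℕ) (s : ℝ) : 0 ≤ rhoAux r n s :=
  mul_nonneg (Real.smoothTransition.nonneg _) (Real.smoothTransition.nonneg _)

lemma rhoAux_le_one (r : ℝ) (n : ℕ) (s : ℝ) : rhoAux r n s ≤ 1 :=
  mul_le_one₀ (Real.smoothTransition.le_one _) (Real.smoothTransition.nonneg _)
    (Real.smoothTransition.le_one _)

lemma rhoAux_abs (r : ℝ) (n : ℕ) (s : ℝ) : |rhoAux r n s| ≤ 1 := by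
  rw [abs_of_nonneg (rhoAux_nonneg r n s)]; exact rhoAux_le_one r n s

lemma rhoAux_zero_left (r : ℝ) (n : ℕ) (s : ℝ) (hs : s ≤ r ^ 2) : rhoAux r n s = 0 := by
  unfold rhoAux
  rw [Real.smoothTransition.zero_of_nonpos, zero_mul]
  exact mul_nonpos_of_nonneg_of_nonpos (by positivity) (by linarith)

lemma rhoAux_zero_right (r : ℝ) (n : ℕ) (s : ℝ) (hs : 1 - ((n : ℝ) + 1)⁻¹ ≤ s) :
    rhoAux r n s = 0 := by
  unfold rhoAux
  rw [Real.smoothTransition.zero_of_nonpos (x := ((n : ℝ) + 1) * (1 - s) - 1), mul_zero]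
  have h : (0 : ℝ) < (n : ℝ) + 1 := by positivity
  have : ((n : ℝ) + 1) * (1 - s) ≤ ((n : ℝ) + 1) * ((n : ℝ) + 1)⁻¹ :=
    mul_le_mul_of_nonneg_left (by linarith) h.le
  rw [mul_inv_cancel₀ h.ne'] at this
  linarith

lemma rhoAux_tendsto (r s : ℝ) (hs : r ^ 2 < s) (hs1 : s < 1) :
    Tendsto (fun n => rhoAux r n s) atTop (𝓝 1) := by
  have hn : Tendsto (fun n : ℕ => (n : ℝ) + 1) atTop atTop :=
    tendsto_atTop_add_const_right _ _ tendsto_natCast_atTop_atTop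
  have h1 := (hn.atTop_mul_const (show 0 < s - r ^ 2 by linarith)).eventually_ge_atTop 1
  have h2 := (hn.atTop_mul_const (show 0 < 1 - s by linarith)).eventually_ge_atTop 2
  apply tendsto_const_nhds.congr'
  filter_upwards [h1, h2] with n h1 h2
  unfold rhoAux
  rw [Real.smoothTransition.one_of_one_le h1, Real.smoothTransition.one_of_one_le (by linarith),
    mul_one]

lemma FAux_hasDerivAt (r : ℝ) (n : ℕ) (t : ℝ) : HasDerivAt (FAux r n) (- rhoAux r n t) t := by
  have hc := (rhoAux_contDiff r n).continuous
  exact (intervalIntegral.integral_hasDerivAt_right (hc.intervalIntegrable _ _)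
    (hc.stronglyMeasurableAtFilter _ _) hc.continuousAt).neg

lemma FAux_contDiff (r : ℝ) (n : ℕ) : ContDiff ℝ (⊤ : ℕ∞) (FAux r n) := by
  rw [contDiff_infty_iff_deriv]
  refine ⟨fun t => (FAux_hasDerivAt r n t).differentiableAt, ?_⟩
  have : deriv (FAux r n) = fun t => - rhoAux r n t := funext fun t => (FAux_hasDerivAt r n t).deriv
  rw [this]
  exact (rhoAux_contDiff r n).neg

lemma FAux_zero (r : ℝ) (n : ℕ) (t : ℝ) (ht : 1 - ((n : ℝ) + 1)⁻¹ ≤ t) : FAux r n t = 0 := by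
  unfold FAux
  rw [intervalIntegral.integral_zero_ae, neg_zero]
  refine Eventually.of_forall fun s hs => rhoAux_zero_right r n s ?_
  have h : (0 : ℝ) < ((n : ℝ) + 1)⁻¹ := by positivity
  rcases Set.mem_uIoc.1 hs with h | h
  · linarith [h.1]
  · linarith [h.1]

lemma FAux_abs (r : ℝ) (n : ℕ) (t : ℝ) (ht0 : 0 ≤ t) : |FAux r n t| ≤ 1 := by
  by_cases ht : 1 - ((n : ℝ) + 1)⁻¹ ≤ t
  · rw [FAux_zero r n t ht]; simp
  · push Not at ht
    have h : (0 : ℝ) < ((n : ℝ) + 1)⁻¹ := by positivity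
    unfold FAux
    rw [abs_neg]
    have := intervalIntegral.norm_integral_le_of_norm_le_const (a := (1 : ℝ)) (b := t) (C := 1)
      (f := rhoAux r n) (fun s _ => rhoAux_abs r n s)
    rw [Real.norm_eq_abs, one_mul, abs_of_nonpos (by linarith : t - 1 ≤ 0)] at this
    linarith

lemma FAux_tendsto_ge (r t : ℝ) (ht : r ^ 2 ≤ t) (ht1 : t < 1) :
    Tendsto (fun n => FAux r n t) atTop (𝓝 (1 - t)) := by
  have h : Tendsto (fun n => ∫ s in (1 : ℝ)..t, rhoAux r n s) atTop
      (𝓝 (∫ s in (1 : ℝ)..t, (1 : ℝ))) := by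
    apply intervalIntegral.tendsto_integral_filter_of_dominated_convergence (fun _ => 1)
    · exact Eventually.of_forall fun n => (rhoAux_contDiff r n).continuous.aestronglyMeasurable
    · exact Eventually.of_forall fun n => Eventually.of_forall fun s _ => rhoAux_abs r n s
    · exact intervalIntegrable_const
    · have : ∀ᵐ s : ℝ, s ≠ 1 := by
        simp [ae_iff]
      filter_upwards [this] with s hs1 hs
      rw [Set.uIoc_of_ge ht1.le] at hs
      exact rhoAux_tendsto r s (lt_of_le_of_lt ht hs.1) (lt_of_le_of_ne hs.2 hs1)
  have h2 := h.neg
  simp only [intervalIntegral.integral_const, smul_eq_mul, mul_one, neg_sub] at h2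
  exact h2

lemma FAux_left (r : ℝ) (n : ℕ) (t : ℝ) (ht : t ≤ r ^ 2) : FAux r n t = FAux r n (r ^ 2) := by
  have hc := (rhoAux_contDiff r n).continuous
  unfold FAux
  rw [← intervalIntegral.integral_add_adjacent_intervals (hc.intervalIntegrable 1 (r ^ 2))
    (hc.intervalIntegrable (r ^ 2) t)]
  rw [intervalIntegral.integral_zero_ae (a := r ^ 2), add_zero]
  refine Eventually.of_forall fun s hs => rhoAux_zero_left r n s ?_
  rw [Set.uIoc_of_ge ht] at hs
  exact hs.2

section
variable {N : ℕ}

/-- The approximating test functions. -/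
def phiAux (N : ℕ) (r : ℝ) (n : ℕ) (x : EuclideanSpace ℝ (Fin N)) : ℝ := FAux r n (‖x‖ ^ 2)

lemma phiAux_contDiff (r : ℝ) (n : ℕ) : ContDiff ℝ (⊤ : ℕ∞) (phiAux N r n) :=
  (FAux_contDiff r n).comp (contDiff_norm_sq ℝ)

lemma phiAux_hasGradientAt (r : ℝ) (n : ℕ) (x : EuclideanSpace ℝ (Fin N)) :
    HasGradientAt (phiAux N r n) ((-2 * rhoAux r n (‖x‖ ^ 2)) • x) x := by
  rw [hasGradientAt_iff_hasFDerivAt]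
  have h := (FAux_hasDerivAt r n (‖x‖ ^ 2)).comp_hasFDerivAt x
    (hasStrictFDerivAt_norm_sq x).hasFDerivAt
  refine h.congr_fderiv ?_
  ext y
  simp [inner_smul_left]
  ring

lemma phiAux_test (r : ℝ) (n : ℕ) :
    IsTestFun N (Metric.ball (0 : EuclideanSpace ℝ (Fin N)) 1) (phiAux N r n) := by
  have hsub : tsupport (phiAux N r n) ⊆
      {x : EuclideanSpace ℝ (Fin N) | ‖x‖ ^ 2 ≤ 1 - ((n : ℝ) + 1)⁻¹} := by
    apply closure_minimal
    · intro x hx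
      by_contra h
      exact hx (FAux_zero r n _ (le_of_lt (not_le.1 fun h' => h h')))
    · exact isClosed_le (by fun_prop) continuous_const
  have hpos : (0 : ℝ) < ((n : ℝ) + 1)⁻¹ := by positivity
  have hball : tsupport (phiAux N r n) ⊆ Metric.ball 0 1 := by
    intro x hx
    have := hsub hx
    simp only [Set.mem_ofPred_eq] at this
    rw [mem_ball_zero_iff]
    nlinarith [norm_nonneg x]
  refine ⟨phiAux_contDiff r n, ?_, hball⟩
  exact (ProperSpace.isCompact_closedBall (0 : EuclideanSpace ℝ (Fin N)) 1).of_isClosed_subset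
    (isClosed_tsupport _) (hball.trans Metric.ball_subset_closedBall)

lemma phiAux_abs (r : ℝ) (n : ℕ) (x : EuclideanSpace ℝ (Fin N)) : |phiAux N r n x| ≤ 1 :=
  FAux_abs r n _ (by positivity)

lemma phiAux_tendsto (r : ℝ) (hr0 : 0 < r) (hr1 : r < 1) (x : EuclideanSpace ℝ (Fin N))
    (hx : ‖x‖ < 1) : Tendsto (fun n => phiAux N r n x) atTop
      (𝓝 (if r ≤ ‖x‖ then 1 - ‖x‖ ^ 2 else 1 - r ^ 2)) := by
  unfold phiAux
  split_ifs with h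
  · exact FAux_tendsto_ge r _ (by gcongr) (by nlinarith [norm_nonneg x])
  · push Not at h
    simp_rw [fun n => FAux_left r n (‖x‖ ^ 2) (by gcongr)]
    exact FAux_tendsto_ge r _ le_rfl (by nlinarith)

lemma grad_tendsto (r : ℝ) (hr0 : 0 < r) (x : EuclideanSpace ℝ (Fin N))
    (hx : ‖x‖ < 1) : Tendsto (fun n => (-2 * rhoAux r n (‖x‖ ^ 2)) • x) atTop
      (𝓝 (if r < ‖x‖ then (-2 : ℝ) • x else 0)) := by
  split_ifs with h
  · have := ((rhoAux_tendsto r (‖x‖ ^ 2) (by gcongr) (by nlinarith [norm_nonneg x])).const_mul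
      (-2)).smul_const x
    simpa using this
  · push Not at h
    have : ∀ n, rhoAux r n (‖x‖ ^ 2) = 0 := fun n => rhoAux_zero_left r n _ (by gcongr)
    simp [this]

lemma grad_norm (r : ℝ) (n : ℕ) (x : EuclideanSpace ℝ (Fin N)) (hx : ‖x‖ < 1) :
    ‖(-2 * rhoAux r n (‖x‖ ^ 2)) • x‖ ≤ 2 := by
  rw [norm_smul, norm_mul]
  have h1 := rhoAux_abs r n (‖x‖ ^ 2)
  rw [← Real.norm_eq_abs] at h1
  have : ‖(-2 : ℝ)‖ = 2 := by norm_num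
  rw [this]
  nlinarith [norm_nonneg x, norm_nonneg (rhoAux r n (‖x‖ ^ 2))]

lemma u_meas (r : ℝ) : Measurable
    (fun x : EuclideanSpace ℝ (Fin N) => if r ≤ ‖x‖ then 1 - ‖x‖ ^ 2 else 1 - r ^ 2) :=
  Measurable.ite (measurableSet_le measurable_const measurable_norm) (by fun_prop) (by fun_prop)

lemma g_meas (r : ℝ) : Measurable
    (fun x : EuclideanSpace ℝ (Fin N) => if r < ‖x‖ then (-2 : ℝ) • x else 0) :=
  Measurable.ite (measurableSet_lt measurable_const measurable_norm) (by fun_prop) (by fun_prop)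

lemma u_abs (r : ℝ) (hr0 : 0 < r) (hr1 : r < 1) (x : EuclideanSpace ℝ (Fin N)) (hx : ‖x‖ < 1) :
    |(if r ≤ ‖x‖ then 1 - ‖x‖ ^ 2 else 1 - r ^ 2 : ℝ)| ≤ 1 := by
  split_ifs <;> rw [abs_le] <;> constructor <;> nlinarith [norm_nonneg x]

lemma g_norm (r : ℝ) (x : EuclideanSpace ℝ (Fin N)) (hx : ‖x‖ < 1) :
    ‖(if r < ‖x‖ then (-2 : ℝ) • x else 0)‖ ≤ 2 := by
  split_ifs
  · rw [norm_smul]; norm_num; linarith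
  · simp

lemma ball_ae {p : EuclideanSpace ℝ (Fin N) → Prop} (h : ∀ x, ‖x‖ < 1 → p x) :
    ∀ᵐ x ∂(volume.restrict (Metric.ball (0 : EuclideanSpace ℝ (Fin N)) 1)), p x :=
  (ae_restrict_iff' measurableSet_ball).2
    (Eventually.of_forall fun x hx => h x (mem_ball_zero_iff.1 hx))

instance ballFin : IsFiniteMeasure
    (volume.restrict (Metric.ball (0 : EuclideanSpace ℝ (Fin N)) 1)) :=
  ⟨by simpa using measure_ball_lt_top⟩

lemma coord_abs (y : EuclideanSpace ℝ (Fin N)) (i : Fin N) : |y i| ≤ ‖y‖ :=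
  PiLp.norm_apply_le y i

lemma weak_phi (r : ℝ) (n : ℕ) (ψ : EuclideanSpace ℝ (Fin N) → ℝ)
    (hψ : IsTestFun N (Metric.ball (0 : EuclideanSpace ℝ (Fin N)) 1) ψ) (i : Fin N) :
    ∫ x in Metric.ball (0 : EuclideanSpace ℝ (Fin N)) 1,
        phiAux N r n x * fderiv ℝ ψ x (EuclideanSpace.single i 1)
      = - ∫ x in Metric.ball (0 : EuclideanSpace ℝ (Fin N)) 1,
        ((-2 * rhoAux r n (‖x‖ ^ 2)) • x) i * ψ x := by
  obtain ⟨hs, hc, ht⟩ := hψ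
  have hz : ∀ x, x ∉ Metric.ball (0 : EuclideanSpace ℝ (Fin N)) 1 → x ∉ tsupport ψ :=
    fun x hx h => hx (ht h)
  have hψc := hs.continuous
  have hdc : Continuous fun x => fderiv ℝ ψ x (EuclideanSpace.single i 1) :=
    (hs.continuous_fderiv (by simp)).clm_apply continuous_const
  have hd : ∀ x, fderiv ℝ (phiAux N r n) x (EuclideanSpace.single i 1)
      = ((-2 * rhoAux r n (‖x‖ ^ 2)) • x) i := by
    intro x
    rw [(phiAux_hasGradientAt r n x).hasFDerivAt.fderiv, InnerProductSpace.toDual_apply_apply,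
      EuclideanSpace.inner_single_right]
    simp
  have hφc := (phiAux_contDiff (N := N) r n).continuous
  have hφd : Continuous fun x => fderiv ℝ (phiAux N r n) x (EuclideanSpace.single i 1) :=
    ((phiAux_contDiff (N := N) r n).continuous_fderiv (by simp)).clm_apply continuous_const
  rw [setIntegral_eq_integral_of_forall_compl_eq_zero, setIntegral_eq_integral_of_forall_compl_eq_zero]
  · simp_rw [← hd]
    apply integral_mul_fderiv_eq_neg_fderiv_mul_of_integrable
    · exact (hφd.mul hψc).integrable_of_hasCompactSupport hc.mul_left
    · exact (hφc.mul hdc).integrable_of_hasCompactSupport (hc.fderiv_apply ℝ _).mul_left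
    · exact (hφc.mul hψc).integrable_of_hasCompactSupport hc.mul_left
    · exact fun x _ => (phiAux_contDiff r n).differentiable (by simp) x
    · exact fun x _ => hs.differentiable (by simp) x
  · intro x hx
    rw [image_eq_zero_of_notMem_tsupport (hz x hx), mul_zero]
  · intro x hx
    have : fderiv ℝ ψ x = 0 := by
      by_contra h
      exact hz x hx (support_fderiv_subset ℝ h)
    simp [this]

lemma memW (r : ℝ) (hr0 : 0 < r) (hr1 : r < 1) :
    MemW0_1_1 N (Metric.ball (0 : EuclideanSpace ℝ (Fin N)) 1)
      (fun x => if r ≤ ‖x‖ then 1 - ‖x‖ ^ 2 else 1 - r ^ 2)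
      (fun x => if r < ‖x‖ then (-2 : ℝ) • x else 0) := by
  have hGc : ∀ n, Continuous fun x : EuclideanSpace ℝ (Fin N) =>
      (-2 * rhoAux r n (‖x‖ ^ 2)) • x := fun n => by
    have := (rhoAux_contDiff r n).continuous
    fun_prop
  refine ⟨⟨?_, ?_, ?_⟩, phiAux N r, phiAux_test r, ?_, ?_⟩
  · exact Integrable.of_bound (u_meas r).aestronglyMeasurable 1
      (ball_ae fun x hx => u_abs r hr0 hr1 x hx)
  · exact Integrable.of_bound (g_meas r).aestronglyMeasurable 2
      (ball_ae fun x hx => g_norm r x hx)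
  · intro ψ hψ i
    have hdc : Continuous fun x => fderiv ℝ ψ x (EuclideanSpace.single i 1) :=
      (hψ.1.continuous_fderiv (by simp)).clm_apply continuous_const
    have hψi : Integrable ψ := hψ.1.continuous.integrable_of_hasCompactSupport hψ.2.1
    have hdi : Integrable fun x => fderiv ℝ ψ x (EuclideanSpace.single i 1) :=
      hdc.integrable_of_hasCompactSupport (hψ.2.1.fderiv_apply ℝ _)
    have h1 : Tendsto (fun n => ∫ x in Metric.ball (0 : EuclideanSpace ℝ (Fin N)) 1,
        phiAux N r n x * fderiv ℝ ψ x (EuclideanSpace.single i 1)) atTop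
        (𝓝 (∫ x in Metric.ball (0 : EuclideanSpace ℝ (Fin N)) 1,
          (if r ≤ ‖x‖ then 1 - ‖x‖ ^ 2 else 1 - r ^ 2) *
            fderiv ℝ ψ x (EuclideanSpace.single i 1))) := by
      apply tendsto_integral_of_dominated_convergence
        (fun x => |fderiv ℝ ψ x (EuclideanSpace.single i 1)|)
      · exact fun n => ((phiAux_contDiff r n).continuous.mul hdc).aestronglyMeasurable
      · exact hdi.abs.restrict
      · intro n
        refine ball_ae fun x hx => ?_
        rw [norm_mul, Real.norm_eq_abs, Real.norm_eq_abs]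
        exact mul_le_of_le_one_left (abs_nonneg _) (phiAux_abs r n x)
      · exact ball_ae fun x hx => (phiAux_tendsto r hr0 hr1 x hx).mul_const _
    have h2 : Tendsto (fun n => ∫ x in Metric.ball (0 : EuclideanSpace ℝ (Fin N)) 1,
        ((-2 * rhoAux r n (‖x‖ ^ 2)) • x) i * ψ x) atTop
        (𝓝 (∫ x in Metric.ball (0 : EuclideanSpace ℝ (Fin N)) 1,
          (if r < ‖x‖ then (-2 : ℝ) • x else 0 : EuclideanSpace ℝ (Fin N)) i * ψ x)) := by
      have hco : Continuous fun y : EuclideanSpace ℝ (Fin N) => y i := by fun_prop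
      apply tendsto_integral_of_dominated_convergence (fun x => 2 * |ψ x|)
      · exact fun n => ((hco.comp (hGc n)).mul hψ.1.continuous).aestronglyMeasurable
      · exact (hψi.abs.const_mul 2).restrict
      · intro n
        refine ball_ae fun x hx => ?_
        rw [norm_mul, Real.norm_eq_abs, Real.norm_eq_abs]
        exact mul_le_mul_of_nonneg_right ((coord_abs _ i).trans (grad_norm r n x hx)) (abs_nonneg _)
      · exact ball_ae fun x hx =>
          ((hco.tendsto _).comp (grad_tendsto r hr0 x hx)).mul_const _
    refine tendsto_nhds_unique h1 ?_
    simp_rw [fun n => weak_phi r n ψ hψ i]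
    exact h2.neg
  · have : Tendsto (fun n => ∫ x in Metric.ball (0 : EuclideanSpace ℝ (Fin N)) 1,
        |phiAux N r n x - (if r ≤ ‖x‖ then 1 - ‖x‖ ^ 2 else 1 - r ^ 2)|) atTop
        (𝓝 (∫ x in Metric.ball (0 : EuclideanSpace ℝ (Fin N)) 1, (0 : ℝ))) := by
      apply tendsto_integral_of_dominated_convergence (fun _ => 2)
      · exact fun n => ((phiAux_contDiff r n).continuous.measurable.sub
          (u_meas r)).norm.aestronglyMeasurable
      · exact integrable_const _
      · intro n
        refine ball_ae fun x hx => ?_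
        rw [Real.norm_eq_abs, abs_abs]
        have := abs_sub (phiAux N r n x) (if r ≤ ‖x‖ then 1 - ‖x‖ ^ 2 else 1 - r ^ 2)
        have h2 := phiAux_abs r n x
        have h3 := u_abs r hr0 hr1 x hx
        linarith
      · refine ball_ae fun x hx => ?_
        have h := ((phiAux_tendsto r hr0 hr1 x hx).sub_const
          (if r ≤ ‖x‖ then 1 - ‖x‖ ^ 2 else 1 - r ^ 2)).abs
        rw [sub_self, abs_zero] at h
        exact h
    simpa using this
  · simp_rw [fun n x => (phiAux_hasGradientAt (N := N) r n x).gradient]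
    have : Tendsto (fun n => ∫ x in Metric.ball (0 : EuclideanSpace ℝ (Fin N)) 1,
        ‖(-2 * rhoAux r n (‖x‖ ^ 2)) • x - (if r < ‖x‖ then (-2 : ℝ) • x else 0)‖) atTop
        (𝓝 (∫ x in Metric.ball (0 : EuclideanSpace ℝ (Fin N)) 1, (0 : ℝ))) := by
      apply tendsto_integral_of_dominated_convergence (fun _ => 4)
      · exact fun n => ((hGc n).measurable.sub (g_meas r)).norm.aestronglyMeasurable
      · exact integrable_const _
      · intro n
        refine ball_ae fun x hx => ?_
        rw [norm_norm]
        have := norm_sub_le ((-2 * rhoAux r n (‖x‖ ^ 2)) • x)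
          (if r < ‖x‖ then (-2 : ℝ) • x else 0)
        have h2 := grad_norm r n x hx
        have h3 := g_norm r x hx
        linarith
      · refine ball_ae fun x hx => ?_
        simpa using ((grad_tendsto r hr0 x hx).sub_const
          (if r < ‖x‖ then (-2 : ℝ) • x else 0)).norm
    simpa using this

/-- The vector field. -/
def ZAux (N : ℕ) (r : ℝ) (x : EuclideanSpace ℝ (Fin N)) : EuclideanSpace ℝ (Fin N) :=
  -((Real.smoothTransition (2 / r ^ 2 * ‖x‖ ^ 2 - 1)) • ((‖x‖)⁻¹ • x))

lemma ZAux_contDiff (r : ℝ) (hr0 : 0 < r) : ContDiff ℝ (⊤ : ℕ∞) (ZAux N r) := by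
  rw [contDiff_iff_contDiffAt]
  intro x
  by_cases hx : x = 0
  · have : ZAux N r =ᶠ[𝓝 x] fun _ => 0 := by
      have hc : ContinuousAt (fun y : EuclideanSpace ℝ (Fin N) => 2 / r ^ 2 * ‖y‖ ^ 2 - 1) x := by
        fun_prop
      have := hc.eventually_lt_const (u := 0) (by simp [hx])
      filter_upwards [this] with y hy
      unfold ZAux
      rw [Real.smoothTransition.zero_of_nonpos hy.le]
      simp
    exact contDiffAt_const.congr_of_eventuallyEq this
  · unfold ZAux
    have hn : ContDiffAt ℝ (⊤ : ℕ∞) (fun y : EuclideanSpace ℝ (Fin N) => ‖y‖) x :=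
      contDiffAt_norm ℝ hx
    have h1 : ContDiffAt ℝ (⊤ : ℕ∞) (fun y : EuclideanSpace ℝ (Fin N) =>
        Real.smoothTransition (2 / r ^ 2 * ‖y‖ ^ 2 - 1)) x :=
      (Real.smoothTransition.contDiff.comp
        ((contDiff_const.mul (contDiff_norm_sq ℝ)).sub contDiff_const)).contDiffAt
    exact (h1.smul ((hn.inv (norm_ne_zero_iff.2 hx)).smul contDiffAt_id)).neg

lemma ZAux_eq (r : ℝ) (hr0 : 0 < r) (x : EuclideanSpace ℝ (Fin N)) (hx : r ≤ ‖x‖) :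
    ZAux N r x = -((‖x‖)⁻¹ • x) := by
  unfold ZAux
  rw [Real.smoothTransition.one_of_one_le, one_smul]
  have h : r ^ 2 ≤ ‖x‖ ^ 2 := by gcongr
  have : 2 / r ^ 2 * r ^ 2 ≤ 2 / r ^ 2 * ‖x‖ ^ 2 := by gcongr
  rw [div_mul_cancel₀ _ (by positivity)] at this
  linarith

lemma bdd_ball {E : Type*} [NormedAddCommGroup E] (f : EuclideanSpace ℝ (Fin N) → E)
    (hf : Continuous f) :
    ∃ M : ℝ, ∀ x ∈ Metric.ball (0 : EuclideanSpace ℝ (Fin N)) 1, ‖f x‖ ≤ M := by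
  obtain ⟨M, hM⟩ := (ProperSpace.isCompact_closedBall
    (0 : EuclideanSpace ℝ (Fin N)) 1).exists_bound_of_continuousOn hf.continuousOn
  exact ⟨M, fun x hx => hM x (Metric.ball_subset_closedBall hx)⟩

end

/-- For `0 < r < 1`, the function `u_r(x) = 1 - |x|²` for `|x| ≥ r`, `u_r(x) = 1 - r²` for
`|x| < r`, belongs to `W₀^{1,1}(B₁(0))` with weak gradient `g_r(x) = -2x` for `|x| > r`,
`g_r(x) = 0` for `|x| < r`; and there is a smooth bounded vector field `Z` on `B₁(0)` equal to
`-x/|x|` on `{r ≤ |x| < 1}` with `g_r · Z = |g_r|` a.e. and `div Z ∈ L^∞(B₁(0))`. -/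
theorem one_laplacian_flat_example (N : ℕ) (hN : 1 ≤ N) (r : ℝ) (hr0 : 0 < r) (hr1 : r < 1) :
    MemW0_1_1 N (Metric.ball (0 : EuclideanSpace ℝ (Fin N)) 1)
      (fun x => if r ≤ ‖x‖ then 1 - ‖x‖ ^ 2 else 1 - r ^ 2)
      (fun x => if r < ‖x‖ then (-2 : ℝ) • x else 0) ∧
    ∃ Z : EuclideanSpace ℝ (Fin N) → EuclideanSpace ℝ (Fin N),
      ContDiffOn ℝ (⊤ : ℕ∞) Z (Metric.ball (0 : EuclideanSpace ℝ (Fin N)) 1) ∧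
      (∃ M : ℝ, ∀ x ∈ Metric.ball (0 : EuclideanSpace ℝ (Fin N)) 1, ‖Z x‖ ≤ M) ∧
      (∀ x : EuclideanSpace ℝ (Fin N), r ≤ ‖x‖ → ‖x‖ < 1 → Z x = -((‖x‖)⁻¹ • x)) ∧
      (∀ᵐ x ∂(volume.restrict (Metric.ball (0 : EuclideanSpace ℝ (Fin N)) 1)),
        ⟪(if r < ‖x‖ then (-2 : ℝ) • x else 0 : EuclideanSpace ℝ (Fin N)), Z x⟫
          = ‖(if r < ‖x‖ then (-2 : ℝ) • x else 0 : EuclideanSpace ℝ (Fin N))‖) ∧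
      (∃ M' : ℝ, ∀ x ∈ Metric.ball (0 : EuclideanSpace ℝ (Fin N)) 1,
        |∑ i : Fin N, fderiv ℝ Z x (EuclideanSpace.single i 1) i| ≤ M') := by
  refine ⟨memW r hr0 hr1, ZAux N r, (ZAux_contDiff r hr0).contDiffOn,
    bdd_ball _ (ZAux_contDiff r hr0).continuous, fun x hx _ => ZAux_eq r hr0 x hx, ?_, ?_⟩
  · refine ball_ae fun x _ => ?_
    split_ifs with h
    · rw [ZAux_eq r hr0 x h.le, inner_neg_right, inner_smul_left, inner_smul_right,
        real_inner_self_eq_norm_sq, norm_smul]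
      have : ‖x‖ ≠ 0 := (hr0.trans h).ne'
      simp
      field_simp
    · simp
  · refine bdd_ball (fun x => ∑ i : Fin N, fderiv ℝ (ZAux N r) x (EuclideanSpace.single i 1) i) ?_
    refine continuous_finsetSum _ fun i _ => ?_
    have hco : Continuous fun y : EuclideanSpace ℝ (Fin N) => y i := by fun_prop
    exact hco.comp (((ZAux_contDiff r hr0).continuous_fderiv (by simp)).clm_apply continuous_const)
end
end
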